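/- For every (z₁,z₂,w) ∈ ℂ³ with 1 + w ≠ 0, one has the identity Ω( √2·z₁/(1+w), √2·z₂/(1+w), 0, 2i(1−w)/(1+w) ) = R₀(z₁,z₂,w), where Ω(Z₁,Z₂,ζ,W) = ( 2iZ₁/(2i+W), 2iZ₂/(2i+W), ( i − W/2 − iζ − (Wζ + i(Z₁²+Z₂²))/2 )/(2i+W), ( −1 − iW/2 − ζ + (i/2)(Wζ + i(Z₁²+Z₂²)) )/(2i+W) ) and R₀(z₁,z₂,w) = ( z₁/√2, z₂/√2, (2w + 2w² − z₁² − z₂²)/(4(1+w)), i(2w + 2w² + z₁² + z₂²)/(4(1+w)) ). That is, R₀ = Ω ∘ H₁ ∘ Υ₁, where H₁(z,w) = (z₁,z₂,0,w) is the linear embedding and Υ₁(z,w) = ( √2·z₁/(1+w), √2·z₂/(1+w), 2i(1−w)/(1+w) ) is the Cayley-type map. -/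

import Mathlib

open Complex

/-- The local biholomorphism `Ω` sending a piece of the model `𝒳⁷₁` into the boundary of the
generalized Lie ball `D^{IV}_{4,1}`. -/
noncomputable def Omega (Z₁ Z₂ ζ W : ℂ) : ℂ × ℂ × ℂ × ℂ :=
  (2*I*Z₁ / (2*I + W),
   2*I*Z₂ / (2*I + W),
   (I - W/2 - I*ζ - (W*ζ + I*(Z₁^2 + Z₂^2))/2) / (2*I + W),
   (-1 - I*W/2 - ζ + (I/2)*(W*ζ + I*(Z₁^2 + Z₂^2))) / (2*I + W))

/-- The rank-zero proper map `R₀ : 𝔹³₁ → D^{IV}_{4,1}`. -/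
noncomputable def R₀ (z₁ z₂ w : ℂ) : ℂ × ℂ × ℂ × ℂ :=
  (z₁ / (Real.sqrt 2 : ℂ),
   z₂ / (Real.sqrt 2 : ℂ),
   (2*w + 2*w^2 - z₁^2 - z₂^2) / (4*(1 + w)),
   I*(2*w + 2*w^2 + z₁^2 + z₂^2) / (4*(1 + w)))

theorem stmt_15 (z₁ z₂ w : ℂ) (hden : 1 + w ≠ 0) :
    Omega ((Real.sqrt 2 : ℂ) * z₁ / (1 + w)) ((Real.sqrt 2 : ℂ) * z₂ / (1 + w)) 0
        (2*I*(1 - w)/(1 + w))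
      = R₀ z₁ z₂ w := by
  have hsum : 2*I + 2*I*(1 - w)/(1 + w) = 4*I / (1 + w) := by
    field_simp
    ring
  have hsq : (Real.sqrt 2 : ℂ)^2 = 2 := by
    exact_mod_cast Real.sq_sqrt (show (0 : ℝ) ≤ 2 by norm_num)
  have hne : (Real.sqrt 2 : ℂ) ≠ 0 := fun h => by simp [h] at hsq
  have hI : I ≠ 0 := I_ne_zero
  have hlin (z : ℂ) : 2*I*((Real.sqrt 2 : ℂ) * z / (1 + w)) / (4*I / (1 + w))
      = z / (Real.sqrt 2 : ℂ) := by
    rw [div_div_eq_mul_div, div_eq_div_iff (by simp) hne]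
    field_simp
    linear_combination 2 * z * hsq
  simp only [Omega, R₀, Prod.mk.injEq, hsum, hlin, true_and, div_pow, mul_pow, hsq]
  constructor
  · field_simp
    ring
  · rw [div_div_eq_mul_div, div_eq_div_iff (by simp) (by simpa using hden)]
    field_simp
    simp only [I_sq]
    ring
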